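/- arXiv:1601.03180 — 5 statements merged into one kernel-verified Lean document; each statement's English description precedes it below -/
import Mathlib

section
/- For every real x with 0 < x < π/2, one has [π² + ((π²−12)/3)x² + ((384−4π⁴)/(3π⁴))x⁴]/(π² − 4x²) < tan x / x < [π² + ((72−8π²)/π²)x² + ((16π²−160)/π⁴)x⁴]/(π² − 4x²). -/
open Real

lemma hasSum_odd_of {f : ℕ → ℝ} {A B : ℝ} (h : HasSum f A)
    (he : HasSum (fun k => f (2 * k)) B) : HasSum (fun k => f (2 * k + 1)) (A - B) := by
  have ho : Summable (fun k => f (2 * k + 1)) :=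
    h.summable.comp_injective (i := fun k => 2 * k + 1) (fun a b hab => by simpa using hab)
  have := h.unique (HasSum.even_add_odd he ho.hasSum)
  rw [this, add_sub_cancel_left]
  exact ho.hasSum

lemma hasSum_even_of {f : ℕ → ℝ} {A B : ℝ} (h : HasSum f A)
    (he : HasSum (fun k => f (2 * k + 1)) B) : HasSum (fun k => f (2 * k)) (A - B) := by
  have ho : Summable (fun k => f (2 * k)) :=
    h.summable.comp_injective (i := fun k => 2 * k) (fun a b hab => by simpa using hab)
  have := h.unique (HasSum.even_add_odd ho.hasSum he)
  rw [this, add_sub_cancel_right]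
  exact ho.hasSum

lemma sum_two : HasSum (fun k : ℕ => 1 / (2 * (k : ℝ) + 1) ^ 2) (π ^ 2 / 8) := by
  have h := hasSum_odd_of hasSum_zeta_two (B := π ^ 2 / 24) (by
    convert! hasSum_zeta_two.mul_left (1 / 4) using 1
    · funext k; push_cast; rw [mul_pow, one_div, one_div, mul_inv]; norm_num
    · ring)
  convert! h using 1
  · funext k; push_cast; rfl
  · ring

lemma sum_four : HasSum (fun k : ℕ => 1 / (2 * (k : ℝ) + 1) ^ 4) (π ^ 4 / 96) := by
  have h := hasSum_odd_of hasSum_zeta_four (B := π ^ 4 / 1440) (by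
    convert! hasSum_zeta_four.mul_left (1 / 16) using 1
    · funext k; push_cast; rw [mul_pow, one_div, one_div, mul_inv]; norm_num
    · ring)
  convert! h using 1
  · funext k; push_cast; rfl
  · ring

lemma sum_tel : HasSum (fun k : ℕ => 1 / ((2 * (k : ℝ) + 1) ^ 2 - 1)) (1 / 4) := by
  have e : ∀ k : ℕ, (2 * (k : ℝ) + 1) ^ 2 - 1 = 4 * k * (k + 1) := fun k => by ring
  simp_rw [e]
  rw [← hasSum_nat_add_iff' 1]
  rw [hasSum_iff_tendsto_nat_of_nonneg (fun i => by positivity)]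
  have : ∀ n : ℕ, ∑ i ∈ Finset.range n,
      1 / (4 * ((i + 1 : ℕ) : ℝ) * (((i + 1 : ℕ) : ℝ) + 1)) = 1 / 4 - 1 / 4 * (1 / ((n : ℝ) + 1)) := by
    intro n
    induction n with
    | zero => simp
    | succ n ih => rw [Finset.sum_range_succ, ih]; push_cast; field_simp; ring
  simp_rw [this]
  have := (tendsto_one_div_add_atTop_nhds_zero_nat (𝕜 := ℝ)).const_mul (1 / 4)
  have h2 := this.const_sub (1 / 4)
  norm_num at h2 ⊢
  exact h2

lemma cot_real (z : ℝ) (h0 : 0 < z) (h1 : z < 1) :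
    HasSum (fun n : ℕ => 1 / (z - (n + 1)) + 1 / (z + (n + 1))) (π * Real.cot (π * z) - 1 / z) := by
  have hz : (z : ℂ) ∈ Complex.integerComplement := by
    rw [Complex.mem_integerComplement_iff]
    rintro ⟨n, hn⟩
    have hn' : (n : ℝ) = z := by exact_mod_cast hn
    rw [← hn'] at h0 h1
    have a : 0 < n := by exact_mod_cast h0
    have b : n < 1 := by exact_mod_cast h1
    omega
  have hs := (summable_cotTerm hz).hasSum
  have e : ∑' n : ℕ, cotTerm z n = π * Complex.cot (π * z) - 1 / z := (cot_series_rep' hz).symm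
  rw [e] at hs
  rw [← Complex.hasSum_ofReal]
  convert! hs using 1
  · funext n; simp [cotTerm]
  · push_cast; rfl

lemma tan_sum (z : ℝ) (h0 : 0 < z) (h1 : z < 1 / 2) :
    HasSum (fun k : ℕ => 1 / ((2 * (k : ℝ) + 1) ^ 2 - 4 * z ^ 2)) (π * Real.tan (π * z) / (8 * z)) := by
  have A := cot_real (2 * z) (by linarith) (by linarith)
  have B := (cot_real z h0 (by linarith)).mul_left (1 / 2)
  have C := hasSum_even_of A (B := 1 / 2 * (π * Real.cot (π * z) - 1 / z)) (by
    convert! B using 1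
    funext k
    push_cast
    have : z - (k + 1) ≠ 0 := by
      have : (0 : ℝ) ≤ k := k.cast_nonneg
      intro h; linarith
    have : z + (k + 1) ≠ 0 := by positivity
    rw [show 2 * z - (2 * (k : ℝ) + 1 + 1) = 2 * (z - (k + 1)) by ring,
      show 2 * z + (2 * (k : ℝ) + 1 + 1) = 2 * (z + (k + 1)) by ring]
    field_simp)
  have D := C.mul_left (-1 / (4 * z))
  convert! D using 1
  · funext k
    push_cast
    have hk : (0 : ℝ) ≤ k := k.cast_nonneg
    have a : 2 * z - (2 * k + 1) ≠ 0 := by intro h; linarith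
    have b : 2 * z + (2 * k + 1) ≠ 0 := by positivity
    rw [show (2 * (k : ℝ) + 1) ^ 2 - 4 * z ^ 2 = -((2 * z - (2 * k + 1)) * (2 * z + (2 * k + 1))) by ring]
    field_simp
    ring
  · have hp : π * z < π / 2 := by nlinarith [pi_pos]
    have hp0 : 0 < π * z := by positivity
    have hs : Real.sin (π * z) ≠ 0 := (Real.sin_pos_of_pos_of_lt_pi hp0 (by linarith)).ne'
    have hc : Real.cos (π * z) ≠ 0 := (Real.cos_pos_of_mem_Ioo ⟨by linarith, hp⟩).ne'
    rw [Real.cot_eq_cos_div_sin, Real.cot_eq_cos_div_sin, Real.tan_eq_sin_div_cos,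
      show π * (2 * z) = 2 * (π * z) by ring, Real.sin_two_mul, Real.cos_two_mul]
    field_simp
    have := Real.sin_sq_add_cos_sq (π * z)
    linear_combination (8 * π * z) * this

lemma bounds (s T : ℝ) (h0 : 0 < s) (h1 : s < 1)
    (hT : HasSum (fun k : ℕ => 1 / ((2 * (k : ℝ) + 1) ^ 2 - s)) T) :
    π ^ 2 / 8 + s * (π ^ 4 / 96) + (1 / (1 - s) - 1 - s) < T ∧
    T < π ^ 2 / 8 + s * (1 / 4 - π ^ 2 / 8) + (1 / (1 - s) - 1 + s) := by
  have hL := (sum_two.add (sum_four.mul_left s)).add (hasSum_ite_eq (0 : ℕ) (1 / (1 - s) - 1 - s))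
  have hU := (sum_two.add ((sum_tel.sub sum_two).mul_left s)).add
    (hasSum_ite_eq (0 : ℕ) (1 / (1 - s) - 1 + s))
  have keyL : ∀ M : ℝ, 1 < M → 1 / M + s * (1 / M ^ 2) < 1 / (M - s) := by
    intro M hM
    have : 0 < M - s := by linarith
    have e : 1 / (M - s) - (1 / M + s * (1 / M ^ 2)) = s ^ 2 / (M ^ 2 * (M - s)) := by
      field_simp; ring
    have : 0 < s ^ 2 / (M ^ 2 * (M - s)) := by positivity
    linarith
  have keyU : ∀ M : ℝ, 1 < M → 1 / (M - s) < 1 / M + s * (1 / (M - 1) - 1 / M) := by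
    intro M hM
    have : 0 < M - s := by linarith
    have : 0 < M - 1 := by linarith
    have : 0 < 1 - s := by linarith
    have e : (1 / M + s * (1 / (M - 1) - 1 / M)) - 1 / (M - s)
        = s * (1 - s) / (M * (M - 1) * (M - s)) := by
      field_simp; ring
    have : 0 < s * (1 - s) / (M * (M - 1) * (M - s)) := by positivity
    linarith
  have hM : ∀ k : ℕ, k ≠ 0 → 1 < (2 * (k : ℝ) + 1) ^ 2 := by
    intro k hk
    have : (0 : ℝ) < k := by exact_mod_cast Nat.pos_of_ne_zero hk
    nlinarith
  have tL : ∀ k : ℕ, k ≠ 0 → 1 / (2 * (k : ℝ) + 1) ^ 2 + s * (1 / (2 * (k : ℝ) + 1) ^ 4)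
      + (if k = 0 then 1 / (1 - s) - 1 - s else 0) < 1 / ((2 * (k : ℝ) + 1) ^ 2 - s) := by
    intro k hk
    have := keyL _ (hM k hk)
    rw [if_neg hk, add_zero]
    rwa [← pow_mul] at this
  have tU : ∀ k : ℕ, k ≠ 0 → 1 / ((2 * (k : ℝ) + 1) ^ 2 - s) < 1 / (2 * (k : ℝ) + 1) ^ 2
      + s * (1 / ((2 * (k : ℝ) + 1) ^ 2 - 1) - 1 / (2 * (k : ℝ) + 1) ^ 2)
      + (if k = 0 then 1 / (1 - s) - 1 + s else 0) := by
    intro k hk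
    have := keyU _ (hM k hk)
    rwa [if_neg hk, add_zero]
  constructor
  · refine hasSum_lt (i := 1) (fun k => ?_) (tL 1 one_ne_zero) hL hT
    by_cases hk : k = 0
    · subst hk; apply le_of_eq; norm_num
    · exact (tL k hk).le
  · refine hasSum_lt (i := 1) (fun k => ?_) (tU 1 one_ne_zero) hT hU
    by_cases hk : k = 0
    · subst hk; apply le_of_eq; norm_num; ring
    · exact (tU k hk).le

theorem tan_Becker_Stark_improvement (x : ℝ) (hx0 : 0 < x) (hx : x < π / 2) :
    (π^2 + ((π^2 - 12)/3) * x^2 + ((384 - 4*π^4)/(3*π^4)) * x^4) / (π^2 - 4*x^2)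
      < Real.tan x / x ∧
    Real.tan x / x <
      (π^2 + ((72 - 8*π^2)/π^2) * x^2 + ((16*π^2 - 160)/π^4) * x^4) / (π^2 - 4*x^2) := by
  have hp := pi_pos
  obtain ⟨z, rfl⟩ : ∃ z, x = π * z := ⟨x / π, by field_simp⟩
  have h0 : 0 < z := by
    by_contra h
    nlinarith
  have h1 : z < 1 / 2 := by
    by_contra h
    nlinarith
  have hs : 0 < 1 - 4 * z ^ 2 := by nlinarith
  have hs' : 1 - 4 * z ^ 2 ≠ 0 := hs.ne'
  obtain ⟨hL, hU⟩ := bounds (4 * z ^ 2) _ (by positivity) (by linarith) (tan_sum z h0 h1)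
  have e : Real.tan (π * z) / (π * z)
      = 8 / π ^ 2 * (π * Real.tan (π * z) / (8 * z)) := by field_simp
  have d : π ^ 2 - 4 * (π * z) ^ 2 = π ^ 2 * (1 - 4 * z ^ 2) := by ring
  have hc : 0 < 8 / π ^ 2 := by positivity
  rw [e, d]
  constructor
  · refine lt_of_eq_of_lt ?_ (mul_lt_mul_of_pos_left hL hc)
    have k : 1 / (1 - 4 * z ^ 2) - 1 - 4 * z ^ 2 = 16 * z ^ 4 * (1 / (1 - 4 * z ^ 2)) := by
      have := mul_one_div_cancel hs'
      linear_combination (1 + 4 * z ^ 2) * this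
    rw [k, div_eq_iff (by positivity)]
    have := mul_one_div_cancel hs'
    generalize 1 / (1 - 4 * z ^ 2) = r at this ⊢
    have e2 : 8 / π ^ 2 * (π ^ 2 / 8 + 4 * z ^ 2 * (π ^ 4 / 96) + 16 * z ^ 4 * r)
        * (π ^ 2 * (1 - 4 * z ^ 2))
        = 8 * ((π ^ 2 / 8 + 4 * z ^ 2 * (π ^ 4 / 96)) * (1 - 4 * z ^ 2)
          + 16 * z ^ 4 * ((1 - 4 * z ^ 2) * r)) := by
      field_simp
    rw [e2, this]
    field_simp
    ring
  · refine lt_of_lt_of_eq (mul_lt_mul_of_pos_left hU hc) ?_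
    field_simp
    ring
end

section
/- For every real t ≠ 0, one has [π² + (4 − π²/3)t² − (4/3 − 128/π⁴)t⁴]/(π² + 4t²) < tanh t / t < [π² + (4 − π²/3)t² − (4/3 − 2π²/15)t⁴ + (8/15 − 512/π⁶)t⁶]/(π² + 4t²). -/
open Real

lemma coth_hasSum (s : ℝ) (hs : s ≠ 0) :
    HasSum (fun n : ℕ => 2 / (s ^ 2 + (n : ℝ) ^ 2 * π ^ 2))
      (Real.cosh s / (s * Real.sinh s) + 1 / s ^ 2) := by
  have hpi : (π : ℂ) ≠ 0 := by exact_mod_cast Real.pi_ne_zero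
  have hsC : (s : ℂ) ≠ 0 := by exact_mod_cast hs
  have hsinh : Real.sinh s ≠ 0 := by simpa using hs
  have hsinhC : Complex.sinh (s : ℂ) ≠ 0 := by
    rw [← Complex.ofReal_sinh]; exact_mod_cast hsinh
  have hx : ((s : ℂ) * Complex.I / π) ∈ Complex.integerComplement := by
    rintro ⟨k, hk⟩
    have h2 := congrArg Complex.im hk
    have h3 : ((s : ℂ) * Complex.I / π) = ((s / π : ℝ) : ℂ) * Complex.I := by
      push_cast; ring
    rw [h3, Complex.im_ofReal_mul] at h2
    have h4 : s / π ≠ 0 := div_ne_zero hs Real.pi_ne_zero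
    simp at h2
    exact h4 h2.symm
  have h1 : HasSum (fun n : ℕ => cotTerm ((s : ℂ) * Complex.I / π) n)
      (π * Complex.cot (π * ((s : ℂ) * Complex.I / π)) - 1 / ((s : ℂ) * Complex.I / π)) :=
    (Summable.hasSum_iff_tendsto_nat (summable_cotTerm hx)).mpr
      (tendsto_logDeriv_euler_cot_sub hx)
  have h2 := h1.mul_left (Complex.I / (π * s))
  have e1 : Complex.I / (π * s) * (π * Complex.cot (π * ((s : ℂ) * Complex.I / π))
      - 1 / ((s : ℂ) * Complex.I / π))
      = ((Real.cosh s / (s * Real.sinh s) - 1 / s ^ 2 : ℝ) : ℂ) := by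
    rw [mul_div_cancel₀ _ hpi, Complex.cot, Complex.cos_mul_I, Complex.sin_mul_I]
    push_cast
    field_simp
  have e2 : ∀ n : ℕ, Complex.I / (π * s) * cotTerm ((s : ℂ) * Complex.I / π) n
      = ((2 / (s ^ 2 + ((n + 1 : ℕ) : ℝ) ^ 2 * π ^ 2) : ℝ) : ℂ) := by
    intro n
    have hd : (s ^ 2 + ((n : ℝ) + 1) ^ 2 * π ^ 2) ≠ 0 := by positivity
    have hdC : ((s : ℂ) ^ 2 + ((n : ℂ) + 1) ^ 2 * π ^ 2) ≠ 0 := by exact_mod_cast hd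
    have e3 : ((s : ℂ) * Complex.I / π + (n + 1)) * ((s : ℂ) * Complex.I / π - (n + 1))
        = -((s : ℂ) ^ 2 + ((n : ℂ) + 1) ^ 2 * π ^ 2) / π ^ 2 := by
      field_simp
      ring_nf
      rw [Complex.I_sq]; ring
    rw [cotTerm_identity hx, e3]
    push_cast
    field_simp
    rw [Complex.I_sq]; ring
  rw [e1] at h2
  simp_rw [e2] at h2
  rw [Complex.hasSum_ofReal] at h2
  rw [← hasSum_nat_add_iff' 1]
  convert! h2 using 1
  simp only [Finset.sum_range_one, Nat.cast_zero]
  field_simp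
  ring

lemma odd_hasSum (f : ℕ → ℝ) (a b : ℝ) (h : HasSum f a)
    (he : HasSum (fun n => f (2 * n)) b) : HasSum (fun n => f (2 * n + 1)) (a - b) := by
  have hs : Summable (fun n => f (2 * n + 1)) :=
    h.summable.comp_injective (i := fun n : ℕ => 2 * n + 1) (fun x y hxy => by simpa using hxy)
  have := h.unique (he.even_add_odd hs.hasSum)
  have e : a - b = ∑' n, f (2 * n + 1) := by linarith
  rw [e]
  exact hs.hasSum

lemma tanh_hasSum (t : ℝ) (ht : t ≠ 0) :
    HasSum (fun n : ℕ => 8 / (4 * t ^ 2 + (2 * (n : ℝ) + 1) ^ 2 * π ^ 2))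
      (Real.tanh t / t) := by
  have h1 := (coth_hasSum (2 * t) (by simpa using ht)).mul_left 4
  have h2 := coth_hasSum t ht
  have hsinh : Real.sinh t ≠ 0 := by simpa using ht
  have hc : Real.cosh t ≠ 0 := (Real.cosh_pos t).ne'
  have h3 := odd_hasSum _ _ _ h1 (by
    convert! h2 using 2 with n
    push_cast
    have hd : (t ^ 2 + (n : ℝ) ^ 2 * π ^ 2) ≠ 0 := by positivity
    have hd2 : ((2 * t) ^ 2 + (2 * (n : ℝ)) ^ 2 * π ^ 2) ≠ 0 := by positivity
    rw [mul_div_assoc', div_eq_div_iff hd2 hd]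
    ring)
  convert! h3 using 1
  · ext n
    push_cast
    ring
  · rw [Real.tanh_eq_sinh_div_cosh, Real.cosh_two_mul, Real.sinh_two_mul]
    field_simp
    ring

lemma zeta_six : HasSum (fun n : ℕ => (1 : ℝ) / (n : ℝ) ^ 6) (π ^ 6 / 945) := by
  have b6 : bernoulli' 6 = 1 / 42 := by
    have h4 : Nat.choose 6 2 = 15 := by decide
    have h5 : Nat.choose 6 4 = 15 := by decide
    have b5 : bernoulli' 5 = 0 := bernoulli'_eq_zero_of_odd (by decide) (by norm_num)
    rw [bernoulli'_def]
    norm_num [Finset.sum_range_succ, h4, h5, b5]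
  convert! hasSum_zeta_nat (k := 3) (by norm_num) using 1
  simp only [Nat.reduceAdd, Nat.reduceMul]
  rw [bernoulli_eq_bernoulli'_of_ne_one (by norm_num), b6]
  simp [Nat.factorial]; ring

lemma odd_zeta (k : ℕ) (a : ℝ) (h : HasSum (fun n : ℕ => (1 : ℝ) / (n : ℝ) ^ k) a) :
    HasSum (fun n : ℕ => (1 : ℝ) / (2 * (n : ℝ) + 1) ^ k) (a - 1 / 2 ^ k * a) := by
  have := odd_hasSum _ _ (1 / 2 ^ k * a) h (by
    convert! h.mul_left (1 / 2 ^ k) using 2 with n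
    push_cast
    rw [mul_pow]; ring)
  simpa using this

lemma term_lower (p x M : ℝ) (hp : 0 < p) (hx : 0 < x) (hM : 1 < M) :
    1 / M + (1 / M - 1 / M ^ 2) * (x / p) - (1 / M ^ 2) * (x / p) ^ 2
      < (p + x) / (x + M * p) := by
  obtain ⟨y, rfl⟩ : ∃ y, x = y * p := ⟨x / p, by field_simp⟩
  have hy : 0 < y := by
    by_contra h
    nlinarith
  have hM0 : 0 < M := by linarith
  rw [mul_div_cancel_right₀ _ hp.ne']
  have e : (p + y * p) / (y * p + M * p) - (1 / M + (1 / M - 1 / M ^ 2) * y - (1 / M ^ 2) * y ^ 2)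
      = y ^ 2 * (y + 1) / (M ^ 2 * (y + M)) := by
    have : (p + y * p) / (y * p + M * p) = (1 + y) / (y + M) := by
      rw [div_eq_div_iff (by positivity) (by positivity)]; ring
    rw [this]
    have h : y + M ≠ 0 := by positivity
    field_simp
    ring
  have : 0 < y ^ 2 * (y + 1) / (M ^ 2 * (y + M)) := by positivity
  linarith

lemma term_upper (p x M : ℝ) (hp : 0 < p) (hx : 0 < x) (hM : 1 < M) :
    (p + x) / (x + M * p) < 
    1 / M + (1 / M - 1 / M ^ 2) * (x / p) - (1 / M ^ 2 - 1 / M ^ 3) * (x / p) ^ 2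
      + (1 / M ^ 3) * (x / p) ^ 3 := by
  obtain ⟨y, rfl⟩ : ∃ y, x = y * p := ⟨x / p, by field_simp⟩
  have hy : 0 < y := by
    by_contra h
    nlinarith
  have hM0 : 0 < M := by linarith
  rw [mul_div_cancel_right₀ _ hp.ne']
  have e : (1 / M + (1 / M - 1 / M ^ 2) * y - (1 / M ^ 2 - 1 / M ^ 3) * y ^ 2
      + (1 / M ^ 3) * y ^ 3) - (p + y * p) / (y * p + M * p)
      = y ^ 3 * (y + 1) / (M ^ 3 * (y + M)) := by
    have : (p + y * p) / (y * p + M * p) = (1 + y) / (y + M) := by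
      rw [div_eq_div_iff (by positivity) (by positivity)]; ring
    rw [this]
    have h : y + M ≠ 0 := by positivity
    field_simp
    ring
  have : 0 < y ^ 3 * (y + 1) / (M ^ 3 * (y + M)) := by positivity
  linarith

theorem tanh_div_self_rational_bounds (t : ℝ) (ht : t ≠ 0) :
    (π^2 + (4 - π^2/3) * t^2 - (4/3 - 128/π^4) * t^4) / (π^2 + 4*t^2)
      < Real.tanh t / t ∧
    Real.tanh t / t <
      (π^2 + (4 - π^2/3) * t^2 - (4/3 - 2*π^2/15) * t^4 + (8/15 - 512/π^6) * t^6) /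
        (π^2 + 4*t^2) := by
  have hpi := Real.pi_pos
  have hp : 0 < π ^ 2 := by positivity
  have hx : 0 < 4 * t ^ 2 := by positivity
  have hD : 0 < π ^ 2 + 4 * t ^ 2 := by positivity
  have hT := (tanh_hasSum t ht).mul_left (π ^ 2 + 4 * t ^ 2)
  have z2 := odd_zeta 2 _ hasSum_zeta_two
  have z4 := odd_zeta 4 _ hasSum_zeta_four
  have z6 := odd_zeta 6 _ zeta_six
  have z0 := hasSum_ite_eq (0 : ℕ) (1 : ℝ)
  have hM : ∀ n : ℕ, n ≠ 0 → 1 < (2 * (n : ℝ) + 1) ^ 2 := by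
    intro n hn
    have : (1 : ℝ) ≤ n := by exact_mod_cast Nat.one_le_iff_ne_zero.mpr hn
    nlinarith
  set y : ℝ := 4 * t ^ 2 / π ^ 2 with hy
  have hT0 : (π ^ 2 + 4 * t ^ 2) * (8 / (4 * t ^ 2 + π ^ 2)) = 8 := by
    field_simp; ring
  constructor
  · rw [div_lt_iff₀ hD, mul_comm (Real.tanh t / t)]
    have hL := ((z2.add ((z2.sub z4).mul_right y)).sub ((z4.sub z0).mul_right (y ^ 2))).mul_left 8
    have key : ∀ n : ℕ, n ≠ 0 → 8 * (1 / (2 * (n : ℝ) + 1) ^ 2 + (1 / (2 * (n : ℝ) + 1) ^ 2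
        - 1 / (2 * (n : ℝ) + 1) ^ 4) * y
        - (1 / (2 * (n : ℝ) + 1) ^ 4 - if n = 0 then 1 else 0) * y ^ 2)
        < (π ^ 2 + 4 * t ^ 2) * (8 / (4 * t ^ 2 + (2 * (n : ℝ) + 1) ^ 2 * π ^ 2)) := by
      intro n hn
      have := term_lower (π ^ 2) (4 * t ^ 2) _ hp hx (hM n hn)
      rw [← hy, ← pow_mul] at this
      rw [if_neg hn, sub_zero, mul_div_left_comm (π ^ 2 + 4 * t ^ 2) 8]
      exact mul_lt_mul_of_pos_left this (by norm_num : (0 : ℝ) < 8)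
    have hlt := hasSum_lt (i := 1) (fun n => by
      by_cases hn : n = 0
      · subst hn
        simp [hT0]
      · exact (key n hn).le) (key 1 one_ne_zero) hL hT
    refine lt_of_eq_of_lt ?_ hlt
    rw [hy]
    field_simp
    ring
  · rw [lt_div_iff₀ hD, mul_comm (Real.tanh t / t)]
    have hL := (((z2.add ((z2.sub z4).mul_right y)).sub ((z4.sub z6).mul_right (y ^ 2))).add
      ((z6.sub z0).mul_right (y ^ 3))).mul_left 8
    have key : ∀ n : ℕ, n ≠ 0 →
        (π ^ 2 + 4 * t ^ 2) * (8 / (4 * t ^ 2 + (2 * (n : ℝ) + 1) ^ 2 * π ^ 2)) <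
        8 * (1 / (2 * (n : ℝ) + 1) ^ 2 + (1 / (2 * (n : ℝ) + 1) ^ 2
        - 1 / (2 * (n : ℝ) + 1) ^ 4) * y
        - (1 / (2 * (n : ℝ) + 1) ^ 4 - 1 / (2 * (n : ℝ) + 1) ^ 6) * y ^ 2
        + (1 / (2 * (n : ℝ) + 1) ^ 6 - if n = 0 then 1 else 0) * y ^ 3) := by
      intro n hn
      have := term_upper (π ^ 2) (4 * t ^ 2) _ hp hx (hM n hn)
      rw [← hy, ← pow_mul, ← pow_mul] at this
      rw [if_neg hn, sub_zero, mul_div_left_comm (π ^ 2 + 4 * t ^ 2) 8]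
      exact mul_lt_mul_of_pos_left this (by norm_num : (0 : ℝ) < 8)
    have hlt := hasSum_lt (i := 1) (fun n => by
      by_cases hn : n = 0
      · subst hn
        simp [hT0]
      · exact (key n hn).le) (key 1 one_ne_zero) hT hL
    refine lt_of_lt_of_eq hlt ?_
    rw [hy]
    field_simp
    ring
end

section
/- For every real t with 0 < |t| < π/2, one has [π² + ((28−8π)/π)t² + ((−48+16π)/π³)t⁴]/(π² − 4t²) < sec t < [π² − ((8−π²)/2)t² − ((4π³−128)/(2π³))t⁴]/(π² − 4t²). -/
open Real

theorem mono_aux (f f' : ℝ → ℝ) (hf : ∀ x, HasDerivAt f (f' x) x) (h0 : f 0 = 0)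
    (hp : ∀ x, 0 ≤ x → 0 ≤ f' x) (x : ℝ) (hx : 0 ≤ x) : 0 ≤ f x := by
  have hm : MonotoneOn f (Set.Ici 0) := by
    apply monotoneOn_of_deriv_nonneg (convex_Ici 0)
    · exact fun y _ => (hf y).continuousAt.continuousWithinAt
    · exact fun y _ => (hf y).differentiableAt.differentiableWithinAt
    · intro y hy
      rw [interior_Ici] at hy
      rw [(hf y).deriv]
      exact hp y (le_of_lt hy)
  have := hm (Set.mem_Ici.2 le_rfl) (Set.mem_Ici.2 hx) hx
  rwa [h0] at this

theorem cos_l2 (x : ℝ) (hx : 0 ≤ x) : 0 ≤ cos x - 1 + 1/2*x^2 := by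
  refine mono_aux (fun x => cos x - 1 + 1/2*x^2) (fun x => x - sin x) ?_ (by simp) (fun x hx => by linarith [sin_le hx]) x hx
  intro x
  have := ((hasDerivAt_cos x).sub_const 1).add ((hasDerivAt_pow 2 x).const_mul (1/2:ℝ))
  refine HasDerivAt.congr_deriv this ?_
  norm_num
  try ring

theorem sin_l3 (x : ℝ) (hx : 0 ≤ x) : 0 ≤ sin x - x + 1/6*x^3 := by
  refine mono_aux (fun x => sin x - x + 1/6*x^3) (fun x => cos x - 1 + 1/2*x^2) ?_ (by simp) cos_l2 x hx
  intro x
  have := ((hasDerivAt_sin x).sub (hasDerivAt_id x)).add ((hasDerivAt_pow 3 x).const_mul (1/6:ℝ))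
  refine HasDerivAt.congr_deriv this ?_
  norm_num
  try ring

theorem cos_u4 (x : ℝ) (hx : 0 ≤ x) : 0 ≤ 1/24*x^4 - 1/2*x^2 - (cos x - 1) := by
  refine mono_aux (fun x => 1/24*x^4 - 1/2*x^2 - (cos x - 1)) (fun x => sin x - x + 1/6*x^3) ?_ (by simp) sin_l3 x hx
  intro x
  have := (((hasDerivAt_pow 4 x).const_mul (1/24:ℝ)).sub ((hasDerivAt_pow 2 x).const_mul (1/2:ℝ))).sub ((hasDerivAt_cos x).sub_const 1)
  refine HasDerivAt.congr_deriv this ?_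
  norm_num
  try ring

theorem sin_u5 (x : ℝ) (hx : 0 ≤ x) : 0 ≤ 1/120*x^5 - 1/6*x^3 - (sin x - x) := by
  refine mono_aux (fun x => 1/120*x^5 - 1/6*x^3 - (sin x - x)) (fun x => 1/24*x^4 - 1/2*x^2 - (cos x - 1)) ?_ (by simp) cos_u4 x hx
  intro x
  have := (((hasDerivAt_pow 5 x).const_mul (1/120:ℝ)).sub ((hasDerivAt_pow 3 x).const_mul (1/6:ℝ))).sub ((hasDerivAt_sin x).sub (hasDerivAt_id x))
  refine HasDerivAt.congr_deriv this ?_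
  norm_num
  try ring

theorem cos_l6 (x : ℝ) (hx : 0 ≤ x) : 0 ≤ 1/720*x^6 - 1/24*x^4 + (cos x - 1 + 1/2*x^2) := by
  refine mono_aux (fun x => 1/720*x^6 - 1/24*x^4 + (cos x - 1 + 1/2*x^2)) (fun x => 1/120*x^5 - 1/6*x^3 - (sin x - x)) ?_ (by simp) sin_u5 x hx
  intro x
  have := (((hasDerivAt_pow 6 x).const_mul (1/720:ℝ)).sub ((hasDerivAt_pow 4 x).const_mul (1/24:ℝ))).add (((hasDerivAt_cos x).sub_const 1).add ((hasDerivAt_pow 2 x).const_mul (1/2:ℝ)))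
  refine HasDerivAt.congr_deriv this ?_
  norm_num
  try ring

theorem pi_pow_bounds (k : ℕ) (hk : k ≠ 0) :
    (3.141592 : ℝ)^k < π^k ∧ π^k < (3.141593 : ℝ)^k :=
  ⟨pow_lt_pow_left₀ pi_gt_d6 (by norm_num) hk, pow_lt_pow_left₀ pi_lt_d6 pi_pos.le hk⟩

theorem polyLA (w : ℝ) (h0 : 0 < w) (h1 : w ≤ 1/4) : 0 < π*(1-w) - (1 - π^2*w/8 + π^4*w^2/384)*(π + (7-2*π)*w + (π-3)*w^2) := by
  have l1 := pi_gt_d6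
  have u1 := pi_lt_d6
  have b := pi_pow_bounds
  generalize π = q at *
  obtain ⟨l2, u2⟩ := b 2 (by norm_num)
  obtain ⟨l3, u3⟩ := b 3 (by norm_num)
  obtain ⟨l4, u4⟩ := b 4 (by norm_num)
  obtain ⟨l5, u5⟩ := b 5 (by norm_num)
  obtain ⟨l6, u6⟩ := b 6 (by norm_num)
  obtain ⟨l7, u7⟩ := b 7 (by norm_num)
  obtain ⟨l8, u8⟩ := b 8 (by norm_num)
  obtain ⟨l9, u9⟩ := b 9 (by norm_num)
  norm_num at l2 u2 l3 u3 l4 u4 l5 u5 l6 u6 l7 u7 l8 u8 l9 u9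
  have c0 : (173/10000:ℝ) ≤ (-7)*q^0 + (1)*q^1 + (1/8)*q^3 := by linarith
  have c1 : (-543/10000:ℝ) ≤ (3)*q^0 + (-1)*q^1 + (7/8)*q^2 + (-1/4)*q^3 + (-1/384)*q^5 := by linarith
  have c2 : (-9/1250:ℝ) ≤ (-3/8)*q^2 + (1/8)*q^3 + (-7/384)*q^4 + (1/192)*q^5 := by linarith
  have c3 : (-9/250:ℝ) ≤ (1/128)*q^4 + (-1/384)*q^5 := by linarith
  clear l1 u1 l2 u2 l3 u3 l4 u4 l5 u5 l6 u6 l7 u7 l8 u8 l9 u9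
  have hb : 0 ≤ 1/4 - w := by linarith
  have pos : (0:ℝ) < (173/10000)*w^0 + (-543/10000)*w^1 + (-9/1250)*w^2 + (-9/250)*w^3 := by
    nlinarith [mul_nonneg (pow_nonneg h0.le 0) (pow_nonneg hb 3), mul_nonneg (pow_nonneg h0.le 1) (pow_nonneg hb 2), mul_nonneg (pow_nonneg h0.le 2) (pow_nonneg hb 1), mul_nonneg (pow_nonneg h0.le 3) (pow_nonneg hb 0)]
  have d0 := mul_le_mul_of_nonneg_right c0 (pow_nonneg h0.le 0 : (0:ℝ) ≤ w^0)
  have d1 := mul_le_mul_of_nonneg_right c1 (pow_nonneg h0.le 1 : (0:ℝ) ≤ w^1)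
  have d2 := mul_le_mul_of_nonneg_right c2 (pow_nonneg h0.le 2 : (0:ℝ) ≤ w^2)
  have d3 := mul_le_mul_of_nonneg_right c3 (pow_nonneg h0.le 3 : (0:ℝ) ≤ w^3)
  have e : q*(1-w) - (1 - q^2*w/8 + q^4*w^2/384)*(q + (7-2*q)*w + (q-3)*w^2) = w^1 * (((-7)*q^0 + (1)*q^1 + (1/8)*q^3)*w^0 + ((3)*q^0 + (-1)*q^1 + (7/8)*q^2 + (-1/4)*q^3 + (-1/384)*q^5)*w^1 + ((-3/8)*q^2 + (1/8)*q^3 + (-7/384)*q^4 + (1/192)*q^5)*w^2 + ((1/128)*q^4 + (-1/384)*q^5)*w^3) := by ring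
  rw [e]
  exact mul_pos (pow_pos h0 _) (by linarith)

theorem polyLB (y : ℝ) (h0 : 0 < y) (h1 : y ≤ 1/2) : 0 < π*(1-(1-y)^2) - (π*y/2 - (π*y/2)^3/6 + (π*y/2)^5/120)*(π + (7-2*π)*(1-y)^2 + (π-3)*(1-y)^4) := by
  have l1 := pi_gt_d6
  have u1 := pi_lt_d6
  have b := pi_pow_bounds
  generalize π = q at *
  obtain ⟨l2, u2⟩ := b 2 (by norm_num)
  obtain ⟨l3, u3⟩ := b 3 (by norm_num)
  obtain ⟨l4, u4⟩ := b 4 (by norm_num)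
  obtain ⟨l5, u5⟩ := b 5 (by norm_num)
  obtain ⟨l6, u6⟩ := b 6 (by norm_num)
  obtain ⟨l7, u7⟩ := b 7 (by norm_num)
  obtain ⟨l8, u8⟩ := b 8 (by norm_num)
  obtain ⟨l9, u9⟩ := b 9 (by norm_num)
  norm_num at l2 u2 l3 u3 l4 u4 l5 u5 l6 u6 l7 u7 l8 u8 l9 u9
  have c0 : (1233/10000:ℝ) ≤ (11/2)*q^1 + (-2)*q^2 + (1/12)*q^3 := by linarith
  have c1 : (-503/1250:ℝ) ≤ (-6)*q^1 + (2)*q^2 + (-1/24)*q^3 := by linarith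
  have c2 : (2353/5000:ℝ) ≤ (3/2)*q^1 + (-1/2)*q^2 + (-11/48)*q^3 + (1/12)*q^4 + (-1/960)*q^5 := by linarith
  have c3 : (-413/2000:ℝ) ≤ (1/4)*q^3 + (-1/12)*q^4 + (1/1920)*q^5 := by linarith
  have c4 : (-167/5000:ℝ) ≤ (-1/16)*q^3 + (1/48)*q^4 + (11/3840)*q^5 + (-1/960)*q^6 := by linarith
  have c5 : (451/10000:ℝ) ≤ (-1/320)*q^5 + (1/960)*q^6 := by linarith
  have c6 : (-57/5000:ℝ) ≤ (1/1280)*q^5 + (-1/3840)*q^6 := by linarith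
  clear l1 u1 l2 u2 l3 u3 l4 u4 l5 u5 l6 u6 l7 u7 l8 u8 l9 u9
  have hb : 0 ≤ 1/2 - y := by linarith
  have pos : (0:ℝ) < (1233/10000)*y^0 + (-503/1250)*y^1 + (2353/5000)*y^2 + (-413/2000)*y^3 + (-167/5000)*y^4 + (451/10000)*y^5 + (-57/5000)*y^6 := by
    nlinarith [mul_nonneg (pow_nonneg h0.le 0) (pow_nonneg hb 6), mul_nonneg (pow_nonneg h0.le 1) (pow_nonneg hb 5), mul_nonneg (pow_nonneg h0.le 2) (pow_nonneg hb 4), mul_nonneg (pow_nonneg h0.le 3) (pow_nonneg hb 3), mul_nonneg (pow_nonneg h0.le 4) (pow_nonneg hb 2), mul_nonneg (pow_nonneg h0.le 5) (pow_nonneg hb 1), mul_nonneg (pow_nonneg h0.le 6) (pow_nonneg hb 0)]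
  have d0 := mul_le_mul_of_nonneg_right c0 (pow_nonneg h0.le 0 : (0:ℝ) ≤ y^0)
  have d1 := mul_le_mul_of_nonneg_right c1 (pow_nonneg h0.le 1 : (0:ℝ) ≤ y^1)
  have d2 := mul_le_mul_of_nonneg_right c2 (pow_nonneg h0.le 2 : (0:ℝ) ≤ y^2)
  have d3 := mul_le_mul_of_nonneg_right c3 (pow_nonneg h0.le 3 : (0:ℝ) ≤ y^3)
  have d4 := mul_le_mul_of_nonneg_right c4 (pow_nonneg h0.le 4 : (0:ℝ) ≤ y^4)
  have d5 := mul_le_mul_of_nonneg_right c5 (pow_nonneg h0.le 5 : (0:ℝ) ≤ y^5)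
  have d6 := mul_le_mul_of_nonneg_right c6 (pow_nonneg h0.le 6 : (0:ℝ) ≤ y^6)
  have e : q*(1-(1-y)^2) - (q*y/2 - (q*y/2)^3/6 + (q*y/2)^5/120)*(q + (7-2*q)*(1-y)^2 + (q-3)*(1-y)^4) = y^3 * (((11/2)*q^1 + (-2)*q^2 + (1/12)*q^3)*y^0 + ((-6)*q^1 + (2)*q^2 + (-1/24)*q^3)*y^1 + ((3/2)*q^1 + (-1/2)*q^2 + (-11/48)*q^3 + (1/12)*q^4 + (-1/960)*q^5)*y^2 + ((1/4)*q^3 + (-1/12)*q^4 + (1/1920)*q^5)*y^3 + ((-1/16)*q^3 + (1/48)*q^4 + (11/3840)*q^5 + (-1/960)*q^6)*y^4 + ((-1/320)*q^5 + (1/960)*q^6)*y^5 + ((1/1280)*q^5 + (-1/3840)*q^6)*y^6) := by ring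
  rw [e]
  exact mul_pos (pow_pos h0 _) (by linarith)

theorem polyUA (w : ℝ) (h0 : 0 < w) (h1 : w ≤ 49/100) : 0 < (1 - π^2*w/8 + π^4*w^2/384 - π^6*w^3/46080)*(π + (π^3/8-π)*w + (4-π^3/8)*w^2) - π*(1-w) := by
  have l1 := pi_gt_d6
  have u1 := pi_lt_d6
  have b := pi_pow_bounds
  generalize π = q at *
  obtain ⟨l2, u2⟩ := b 2 (by norm_num)
  obtain ⟨l3, u3⟩ := b 3 (by norm_num)
  obtain ⟨l4, u4⟩ := b 4 (by norm_num)
  obtain ⟨l5, u5⟩ := b 5 (by norm_num)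
  obtain ⟨l6, u6⟩ := b 6 (by norm_num)
  obtain ⟨l7, u7⟩ := b 7 (by norm_num)
  obtain ⟨l8, u8⟩ := b 8 (by norm_num)
  obtain ⟨l9, u9⟩ := b 9 (by norm_num)
  norm_num at l2 u2 l3 u3 l4 u4 l5 u5 l6 u6 l7 u7 l8 u8 l9 u9
  have c0 : (153/10000:ℝ) ≤ (4)*q^0 + (-5/384)*q^5 := by linarith
  have c1 : (-163/5000:ℝ) ≤ (-1/2)*q^2 + (5/384)*q^5 + (7/23040)*q^7 := by linarith
  have c2 : (161/10000:ℝ) ≤ (1/96)*q^4 + (-7/23040)*q^7 + (-1/368640)*q^9 := by linarith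
  have c3 : (-27/10000:ℝ) ≤ (-1/11520)*q^6 + (1/368640)*q^9 := by linarith
  clear l1 u1 l2 u2 l3 u3 l4 u4 l5 u5 l6 u6 l7 u7 l8 u8 l9 u9
  have hb : 0 ≤ 49/100 - w := by linarith
  have pos : (0:ℝ) < (153/10000)*w^0 + (-163/5000)*w^1 + (161/10000)*w^2 + (-27/10000)*w^3 := by
    nlinarith [mul_nonneg (pow_nonneg h0.le 0) (pow_nonneg hb 3), mul_nonneg (pow_nonneg h0.le 1) (pow_nonneg hb 2), mul_nonneg (pow_nonneg h0.le 2) (pow_nonneg hb 1), mul_nonneg (pow_nonneg h0.le 3) (pow_nonneg hb 0)]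
  have d0 := mul_le_mul_of_nonneg_right c0 (pow_nonneg h0.le 0 : (0:ℝ) ≤ w^0)
  have d1 := mul_le_mul_of_nonneg_right c1 (pow_nonneg h0.le 1 : (0:ℝ) ≤ w^1)
  have d2 := mul_le_mul_of_nonneg_right c2 (pow_nonneg h0.le 2 : (0:ℝ) ≤ w^2)
  have d3 := mul_le_mul_of_nonneg_right c3 (pow_nonneg h0.le 3 : (0:ℝ) ≤ w^3)
  have e : (1 - q^2*w/8 + q^4*w^2/384 - q^6*w^3/46080)*(q + (q^3/8-q)*w + (4-q^3/8)*w^2) - q*(1-w) = w^2 * (((4)*q^0 + (-5/384)*q^5)*w^0 + ((-1/2)*q^2 + (5/384)*q^5 + (7/23040)*q^7)*w^1 + ((1/96)*q^4 + (-7/23040)*q^7 + (-1/368640)*q^9)*w^2 + ((-1/11520)*q^6 + (1/368640)*q^9)*w^3) := by ring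
  rw [e]
  exact mul_pos (pow_pos h0 _) (by linarith)

theorem polyUB (y : ℝ) (h0 : 0 < y) (h1 : y ≤ 3/10) : 0 < (π*y/2 - (π*y/2)^3/6)*(π + (π^3/8-π)*(1-y)^2 + (4-π^3/8)*(1-y)^4) - π*(1-(1-y)^2) := by
  have l1 := pi_gt_d6
  have u1 := pi_lt_d6
  have b := pi_pow_bounds
  generalize π = q at *
  obtain ⟨l2, u2⟩ := b 2 (by norm_num)
  obtain ⟨l3, u3⟩ := b 3 (by norm_num)
  obtain ⟨l4, u4⟩ := b 4 (by norm_num)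
  obtain ⟨l5, u5⟩ := b 5 (by norm_num)
  obtain ⟨l6, u6⟩ := b 6 (by norm_num)
  obtain ⟨l7, u7⟩ := b 7 (by norm_num)
  obtain ⟨l8, u8⟩ := b 8 (by norm_num)
  obtain ⟨l9, u9⟩ := b 9 (by norm_num)
  norm_num at l2 u2 l3 u3 l4 u4 l5 u5 l6 u6 l7 u7 l8 u8 l9 u9
  have c0 : (109/2000:ℝ) ≤ (-7)*q^1 + (1)*q^2 + (1/8)*q^4 := by linarith
  have c1 : (-13/50:ℝ) ≤ (12)*q^1 + (-1/2)*q^2 + (-1/12)*q^3 + (-5/16)*q^4 := by linarith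
  have c2 : (4889/10000:ℝ) ≤ (-8)*q^1 + (1/3)*q^3 + (5/24)*q^4 + (-1/192)*q^6 := by linarith
  have c3 : (-7607/10000:ℝ) ≤ (2)*q^1 + (-1/2)*q^3 + (-1/24)*q^4 + (5/384)*q^6 := by linarith
  have c4 : (3209/10000:ℝ) ≤ (1/3)*q^3 + (-1/96)*q^6 := by linarith
  have c5 : (-803/10000:ℝ) ≤ (-1/12)*q^3 + (1/384)*q^6 := by linarith
  clear l1 u1 l2 u2 l3 u3 l4 u4 l5 u5 l6 u6 l7 u7 l8 u8 l9 u9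
  have hb : 0 ≤ 3/10 - y := by linarith
  have pos : (0:ℝ) < (109/2000)*y^0 + (-13/50)*y^1 + (4889/10000)*y^2 + (-7607/10000)*y^3 + (3209/10000)*y^4 + (-803/10000)*y^5 := by
    nlinarith [mul_nonneg (pow_nonneg h0.le 0) (pow_nonneg hb 5), mul_nonneg (pow_nonneg h0.le 1) (pow_nonneg hb 4), mul_nonneg (pow_nonneg h0.le 2) (pow_nonneg hb 3), mul_nonneg (pow_nonneg h0.le 3) (pow_nonneg hb 2), mul_nonneg (pow_nonneg h0.le 4) (pow_nonneg hb 1), mul_nonneg (pow_nonneg h0.le 5) (pow_nonneg hb 0)]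
  have d0 := mul_le_mul_of_nonneg_right c0 (pow_nonneg h0.le 0 : (0:ℝ) ≤ y^0)
  have d1 := mul_le_mul_of_nonneg_right c1 (pow_nonneg h0.le 1 : (0:ℝ) ≤ y^1)
  have d2 := mul_le_mul_of_nonneg_right c2 (pow_nonneg h0.le 2 : (0:ℝ) ≤ y^2)
  have d3 := mul_le_mul_of_nonneg_right c3 (pow_nonneg h0.le 3 : (0:ℝ) ≤ y^3)
  have d4 := mul_le_mul_of_nonneg_right c4 (pow_nonneg h0.le 4 : (0:ℝ) ≤ y^4)
  have d5 := mul_le_mul_of_nonneg_right c5 (pow_nonneg h0.le 5 : (0:ℝ) ≤ y^5)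
  have e : (q*y/2 - (q*y/2)^3/6)*(q + (q^3/8-q)*(1-y)^2 + (4-q^3/8)*(1-y)^4) - q*(1-(1-y)^2) = y^2 * (((-7)*q^1 + (1)*q^2 + (1/8)*q^4)*y^0 + ((12)*q^1 + (-1/2)*q^2 + (-1/12)*q^3 + (-5/16)*q^4)*y^1 + ((-8)*q^1 + (1/3)*q^3 + (5/24)*q^4 + (-1/192)*q^6)*y^2 + ((2)*q^1 + (-1/2)*q^3 + (-1/24)*q^4 + (5/384)*q^6)*y^3 + ((1/3)*q^3 + (-1/96)*q^6)*y^4 + ((-1/12)*q^3 + (1/384)*q^6)*y^5) := by ring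
  rw [e]
  exact mul_pos (pow_pos h0 _) (by linarith)

theorem coreL (x : ℝ) (h0 : 0 < x) (h1 : x < 1) :
    cos (π*x/2) * (π + (7-2*π)*x^2 + (π-3)*x^4) < π*(1-x^2) := by
  have hp := pi_gt_three
  have hL : 0 < π + (7-2*π)*x^2 + (π-3)*x^4 := by
    have : π + (7-2*π)*x^2 + (π-3)*x^4 = π*(1-x^2)^2 + x^2*(7-3*x^2) := by ring
    rw [this]
    have : x^2 < 1 := by nlinarith
    have : 0 < x^2*(7-3*x^2) := mul_pos (by positivity) (by linarith)
    positivity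
  rcases le_total x (1/2) with h | h
  · have hc := cos_u4 (π*x/2) (by positivity)
    have hP := polyLA (x^2) (by positivity) (by nlinarith)
    have := mul_le_mul_of_nonneg_right (show cos (π*x/2) ≤ 1 - π^2*x^2/8 + π^4*(x^2)^2/384 by linarith) hL.le
    linarith
  · obtain ⟨y, rfl⟩ : ∃ y, x = 1 - y := ⟨1 - x, by ring⟩
    have hc := sin_u5 (π*y/2) (by have : 0 ≤ y := by linarith
                                  positivity)
    have hP := polyLB y (by linarith) (by linarith)
    have e : cos (π*(1-y)/2) = sin (π*y/2) := by
      rw [← cos_pi_div_two_sub]; congr 1; ring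
    rw [e]
    have := mul_le_mul_of_nonneg_right (show sin (π*y/2) ≤ π*y/2 - (π*y/2)^3/6 + (π*y/2)^5/120 by linarith) hL.le
    linarith

theorem coreU (x : ℝ) (h0 : 0 < x) (h1 : x < 1) :
    π*(1-x^2) < cos (π*x/2) * (π + (π^3/8-π)*x^2 + (4-π^3/8)*x^4) := by
  have hp := pi_gt_three
  have hL : 0 < π + (π^3/8-π)*x^2 + (4-π^3/8)*x^4 := by
    have : π + (π^3/8-π)*x^2 + (4-π^3/8)*x^4 = (π + π^3/8*x^2)*(1-x^2) + 4*x^4 := by ring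
    rw [this]
    have : 0 < 1 - x^2 := by nlinarith
    positivity
  rcases le_total x (7/10) with h | h
  · have hc := cos_l6 (π*x/2) (by positivity)
    have hP := polyUA (x^2) (by positivity) (by nlinarith)
    have := mul_le_mul_of_nonneg_right (show 1 - π^2*x^2/8 + π^4*(x^2)^2/384 - π^6*(x^2)^3/46080 ≤ cos (π*x/2) by linarith) hL.le
    linarith
  · obtain ⟨y, rfl⟩ : ∃ y, x = 1 - y := ⟨1 - x, by ring⟩
    have hc := sin_l3 (π*y/2) (by have : 0 ≤ y := by linarith
                                  positivity)
    have hP := polyUB y (by linarith) (by linarith)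
    have e : cos (π*(1-y)/2) = sin (π*y/2) := by
      rw [← cos_pi_div_two_sub]; congr 1; ring
    rw [e]
    have := mul_le_mul_of_nonneg_right (show π*y/2 - (π*y/2)^3/6 ≤ sin (π*y/2) by linarith) hL.le
    linarith

theorem sec_rational_bounds (t : ℝ) (ht0 : 0 < |t|) (ht : |t| < π / 2) :
    (π^2 + ((28 - 8*π)/π) * t^2 + ((-48 + 16*π)/π^3) * t^4) / (π^2 - 4*t^2)
      < 1 / Real.cos t ∧
    1 / Real.cos t <
      (π^2 - ((8 - π^2)/2) * t^2 - ((4*π^3 - 128)/(2*π^3)) * t^4) / (π^2 - 4*t^2) := by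
  have hp := pi_pos
  have h2 : t^2 = |t|^2 := (sq_abs t).symm
  have h4 : t^4 = |t|^4 := by rw [show t^4 = (t^2)^2 by ring, h2]; ring
  rw [h2, h4, ← cos_abs t]
  generalize |t| = s at *
  obtain ⟨x, rfl⟩ : ∃ x, s = π*x/2 := ⟨2*s/π, by field_simp⟩
  have hx0 : 0 < x := by
    by_contra hn
    nlinarith
  have hx1 : x < 1 := by
    by_contra hn
    nlinarith
  have hd : 0 < π^2 - 4*(π*x/2)^2 := by
    have : π^2 - 4*(π*x/2)^2 = π^2*(1-x^2) := by ring
    rw [this]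
    have : 0 < 1 - x^2 := by nlinarith
    positivity
  have hc : 0 < cos (π*x/2) := cos_pos_of_mem_Ioo ⟨by linarith, ht⟩
  have hL := mul_lt_mul_of_pos_left (coreL x hx0 hx1) hp
  have hU := mul_lt_mul_of_pos_left (coreU x hx0 hx1) hp
  constructor
  · rw [div_lt_div_iff₀ hd hc]
    have e : π^2 + ((28 - 8*π)/π) * (π*x/2)^2 + ((-48 + 16*π)/π^3) * (π*x/2)^4
        = π * (π + (7-2*π)*x^2 + (π-3)*x^4) := by
      field_simp
      ring
    rw [e]
    linarith
  · rw [div_lt_div_iff₀ hc hd]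
    have e : π^2 - ((8 - π^2)/2) * (π*x/2)^2 - ((4*π^3 - 128)/(2*π^3)) * (π*x/2)^4
        = π * (π + (π^3/8-π)*x^2 + (4-π^3/8)*x^4) := by
      field_simp
      ring
    rw [e]
    linarith
end

section
/- For every real t with 0 < |t| < π, one has (t/sin t)² + t/tan t = 2 + 4t⁴ · Σ_{k=1}^{∞} 1/(π²k² − t²)². -/
open Real

lemma wes_pos (r : ℝ) (k : ℕ) (hr : |r| < π) : 
    0 < (π^2 - r^2) ∧ (π^2 - r^2) * ((k:ℝ)+1)^2 ≤ π^2 * ((k:ℝ)+1)^2 - r^2 := by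
  have h1 : r^2 < π^2 := by
    apply sq_lt_sq'
    · linarith [(abs_lt.1 hr).1]
    · exact (abs_lt.1 hr).2
  have hk : (0:ℝ) ≤ k := Nat.cast_nonneg k
  refine ⟨by linarith, ?_⟩
  nlinarith [mul_nonneg (sq_nonneg r) hk, mul_nonneg (sq_nonneg r) (sq_nonneg (k:ℝ))]

lemma wes_cot (s : ℝ) (hs0 : s ≠ 0) (hs : |s| < π) :
    HasSum (fun k : ℕ => 2 * s / (π^2 * ((k:ℝ)+1)^2 - s^2)) (1 / s - Real.cos s / Real.sin s) := by
  have hpi := Real.pi_pos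
  have hz : ((s / π : ℝ) : ℂ) ∈ Complex.integerComplement := by
    rw [Complex.mem_integerComplement_iff]
    rintro ⟨n, hn⟩
    have hn' : (n : ℝ) = s / π := by exact_mod_cast hn
    have h2 : |(n:ℝ)| < 1 := by
      rw [hn', abs_div, abs_of_pos hpi, div_lt_one hpi]; exact hs
    have h3 : |n| < 1 := by exact_mod_cast h2
    have h4 : n = 0 := Int.abs_lt_one_iff.1 h3
    rw [h4] at hn'
    have : s / π ≠ 0 := div_ne_zero hs0 hpi.ne'
    exact this (by simpa using hn'.symm)
  have hsum := (summable_cotTerm hz).hasSum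
  have hrep := cot_series_rep' hz
  have key : ∀ k : ℕ, cotTerm ((s / π : ℝ) : ℂ) k
      = ((-π * (2 * s / (π^2 * ((k:ℝ)+1)^2 - s^2)) : ℝ) : ℂ) := by
    intro k
    have hp := wes_pos s k hs
    have hne : π^2 * ((k:ℝ)+1)^2 - s^2 ≠ 0 := by
      have : 0 < (π^2 - s^2) * ((k:ℝ)+1)^2 := by have := hp.1; positivity
      linarith [hp.2]
    have e : (π^2 * ((k:ℝ)+1)^2 - s^2) = (π * (k+1) - s) * (π * (k+1)+s) := by ring
    have h1 : s - π * (k+1) ≠ 0 := by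
      intro h; apply hne; rw [e]; rw [show π * ((k:ℝ)+1) - s = -(s - π * (k+1)) by ring, h]; ring
    have h2 : s + π * (k+1) ≠ 0 := by
      intro h; apply hne; rw [e]; rw [show π * ((k:ℝ)+1) + s = (s + π * (k+1)) by ring, h]; ring
    have : (1 / (s / π - (k+1)) + 1 / (s/π + (k+1)) : ℝ) = -π * (2 * s / (π^2 * ((k:ℝ)+1)^2 - s^2)) := by
      rw [show s / π - ((k:ℝ)+1) = (s - π * (k+1)) / π by field_simp,
        show s / π + ((k:ℝ)+1) = (s + π * (k+1)) / π by field_simp]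
      rw [one_div_div, one_div_div, div_add_div _ _ h1 h2, mul_div_assoc', div_eq_div_iff (mul_ne_zero h1 h2) hne]
      ring
    rw [← this]
    simp [cotTerm]
  have hc : (π * Complex.cot (π * ((s / π : ℝ) : ℂ)) - 1 / ((s / π : ℝ) : ℂ))
      = ((-π * (1 / s - Real.cos s / Real.sin s) : ℝ) : ℂ) := by
    have : (π : ℂ) * ((s / π : ℝ) : ℂ) = (s : ℂ) := by
      rw [← Complex.ofReal_mul]; congr 1; field_simp
    rw [this, Complex.cot]
    push_cast
    rw [one_div_div]
    ring
  have h := hsum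
  rw [show (∑' n, cotTerm ((s / π : ℝ) : ℂ) n) = _ from hrep.symm.trans hc] at h
  simp_rw [key] at h
  have h' := Complex.hasSum_ofReal.1 h
  exact (hasSum_mul_left_iff (neg_ne_zero.2 hpi.ne')).1 h'

lemma wes_csc (t : ℝ) (ht0 : t ≠ 0) (ht : |t| < π) :
    HasSum (fun k : ℕ => 2 * (π^2 * ((k:ℝ)+1)^2 + t^2) / (π^2 * ((k:ℝ)+1)^2 - t^2)^2)
      (1 / Real.sin t ^ 2 - 1 / t^2) := by
  obtain ⟨r, hr1, hr2⟩ := exists_between ht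
  have hr0 : 0 ≤ r := (abs_nonneg t).trans hr1.le
  have hsin : Real.sin t ≠ 0 := by
    intro h
    exact ht0 ((Real.sin_eq_zero_iff_of_lt_of_lt (abs_lt.1 ht).1 (abs_lt.1 ht).2).1 h)
  have hrp : |r| < π := by rwa [abs_of_nonneg hr0]
  have hsum : Summable (fun k : ℕ => (4 * π^2 / (π^2 - r^2)^2) * (1 / ((k:ℝ)+1)^2)) := by
    apply Summable.mul_left
    have := (summable_nat_add_iff 1).2 (Real.summable_one_div_nat_pow.2 (one_lt_two))
    simpa using this
  have hbase : ∀ (k : ℕ) (y : ℝ), y ∈ Set.Ioo (-r) r → 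
      (π^2 - r^2) * ((k:ℝ)+1)^2 ≤ π^2 * ((k:ℝ)+1)^2 - y^2 ∧ 0 < π^2 * ((k:ℝ)+1)^2 - y^2 
      ∧ y ^ 2 ≤ π^2 * ((k:ℝ)+1)^2 := by
    intro k y hy
    have hp := wes_pos r k hrp
    have hy2 : y^2 < r^2 := sq_lt_sq' hy.1 hy.2
    have : 0 < (π^2 - r^2) * ((k:ℝ)+1)^2 := by have := hp.1; positivity
    refine ⟨by linarith [hp.2], by linarith [hp.2], by linarith [hp.2]⟩
  have hder : ∀ (k : ℕ) (y : ℝ), y ∈ Set.Ioo (-r) r → 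
      HasDerivAt (fun s => 2 * s / (π^2 * ((k:ℝ)+1)^2 - s^2))
        (2 * (π^2 * ((k:ℝ)+1)^2 + y^2) / (π^2 * ((k:ℝ)+1)^2 - y^2)^2) y := by
    intro k y hy
    have h := ((hasDerivAt_id y).const_mul 2).div (((hasDerivAt_id y).pow 2).const_sub (π^2 * ((k:ℝ)+1)^2)) (hbase k y hy).2.1.ne'
    refine HasDerivAt.congr_deriv (f := fun s => 2 * s / (π^2 * ((k:ℝ)+1)^2 - s^2)) h ?_
    simp
    ring
  have hbd : ∀ (k : ℕ) (y : ℝ), y ∈ Set.Ioo (-r) r → 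
      ‖(2 * (π^2 * ((k:ℝ)+1)^2 + y^2) / (π^2 * ((k:ℝ)+1)^2 - y^2)^2)‖ ≤ 
      (4 * π^2 / (π^2 - r^2)^2) * (1 / ((k:ℝ)+1)^2) := by
    intro k y hy
    obtain ⟨h1, h2, h3⟩ := hbase k y hy
    have h0 := (wes_pos r k hrp).1
    rw [Real.norm_of_nonneg (by positivity)]
    have : (4 * π^2 / (π^2 - r^2)^2) * (1 / ((k:ℝ)+1)^2) = 
      (4 * (π^2 * ((k:ℝ)+1)^2)) / ((π^2 - r^2) * ((k:ℝ)+1)^2)^2 := by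
      have := h0.ne'
      field_simp
    rw [this]
    apply div_le_div₀ (by positivity) (by linarith) (by positivity)
    exact pow_le_pow_left₀ (by positivity) h1 2
  have htm : t ∈ Set.Ioo (-r) r := ⟨(abs_lt.1 hr1).1, (abs_lt.1 hr1).2⟩
  have hD := hasDerivAt_tsum_of_isPreconnected hsum isOpen_Ioo (convex_Ioo (-r) r).isPreconnected
    hder hbd htm (wes_cot t ht0 ht).summable htm
  have hS : Summable (fun k : ℕ => 2 * (π^2 * ((k:ℝ)+1)^2 + t^2) / (π^2 * ((k:ℝ)+1)^2 - t^2)^2) :=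
    Summable.of_norm_bounded hsum (fun k => hbd k t htm)
  have hE : (fun s : ℝ => ∑' k : ℕ, 2 * s / (π^2 * ((k:ℝ)+1)^2 - s^2)) =ᶠ[nhds t]
      (fun s => 1 / s - Real.cos s / Real.sin s) := by
    filter_upwards [isOpen_Ioo.mem_nhds htm, isOpen_ne.mem_nhds ht0] with s hs hs0
    exact (wes_cot s hs0 ((abs_lt.2 hs).trans hr2)).tsum_eq
  have hD2 : HasDerivAt (fun s => 1 / s - Real.cos s / Real.sin s) (1 / Real.sin t ^ 2 - 1 / t^2) t := by
    have h := ((hasDerivAt_const t (1:ℝ)).div (hasDerivAt_id t) ht0).sub 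
      ((Real.hasDerivAt_cos t).div (Real.hasDerivAt_sin t) hsin)
    refine HasDerivAt.congr_deriv (f := fun s => 1 / s - Real.cos s / Real.sin s) h ?_
    have := Real.sin_sq_add_cos_sq t
    have e : -Real.sin t * Real.sin t - Real.cos t * Real.cos t = -1 := by linarith
    rw [e]
    simp
    ring
  have := hD.unique (hD2.congr_of_eventuallyEq hE)
  rw [← this]
  exact hS.hasSum

theorem wilker_expression_series (t : ℝ) (ht0 : 0 < |t|) (ht : |t| < π) :
    (t / Real.sin t)^2 + t / Real.tan t =
      2 + 4*t^4 * ∑' k : ℕ, 1 / (π^2 * ((k:ℝ)+1)^2 - t^2)^2 := by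
  have h0 : t ≠ 0 := abs_pos.1 ht0
  have h := ((wes_csc t h0 ht).mul_left (t^2)).sub ((wes_cot t h0 ht).mul_left t)
  rw [← tsum_mul_left]
  have e : ∀ k : ℕ, t^2 * (2 * (π^2 * ((k:ℝ)+1)^2 + t^2) / (π^2 * ((k:ℝ)+1)^2 - t^2)^2)
      - t * (2 * t / (π^2 * ((k:ℝ)+1)^2 - t^2)) = 4 * t^4 * (1 / (π^2 * ((k:ℝ)+1)^2 - t^2)^2) := by
    intro k
    have hp := wes_pos t k ht
    have hne : π^2 * ((k:ℝ)+1)^2 - t^2 ≠ 0 := by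
      have : 0 < (π^2 - t^2) * ((k:ℝ)+1)^2 := by have := hp.1; positivity
      linarith [hp.2]
    field_simp
    ring
  simp_rw [e] at h
  rw [h.tsum_eq, Real.tan_eq_sin_div_cos]
  have h1 : t * (1 / t) = 1 := by field_simp
  have h2 : t^2 * (1 / t^2) = 1 := by field_simp
  rw [mul_sub, mul_sub, h1, h2, div_div_eq_mul_div]
  ring
end

section
/- For every real t with 0 < t < π/2, one has 2 + (2/45)t⁴ < (t/sin t)² + t/tan t < 2 + (4(π²−8)/π⁴)t⁴. -/
open Real

lemma wq_cot (x : ℝ) (h0 : 0 < x) (h1 : x < 3/4) :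
    HasSum (fun n : ℕ => 1 / (x - ((n:ℝ) + 1)) + 1 / (x + ((n:ℝ) + 1)))
      (π * (Real.cos (π * x) / Real.sin (π * x)) - 1 / x) := by
  have hx : (x : ℂ) ∈ Complex.integerComplement := by
    rintro ⟨n, hn⟩
    have hn' : (n : ℝ) = x := by exact_mod_cast hn
    rw [← hn'] at h0 h1
    have a : 0 < n := by exact_mod_cast h0
    have b : (n : ℝ) < 1 := by linarith
    have b' : n < 1 := by exact_mod_cast b
    omega
  have hs := (summable_cotTerm hx).hasSum
  have he := cot_series_rep' hx
  have hs' : HasSum (fun n : ℕ => 1 / ((x:ℂ) - ((n:ℂ) + 1)) + 1 / ((x:ℂ) + ((n:ℂ) + 1)))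
      (π * Complex.cot (π * x) - 1 / x) := by
    rw [he]; exact hs
  rw [← Complex.hasSum_ofReal]
  rw [Complex.cot] at hs'
  push_cast
  exact hs'

lemma wq_summable : Summable (fun n : ℕ => 17 / ((n:ℝ) + 1)^2) := by
  have h : Summable (fun n : ℕ => 1 / ((n:ℝ))^2) := by
    simpa using Real.summable_one_div_nat_pow.2 one_lt_two
  have h2 := ((summable_nat_add_iff 1).2 h).mul_left 17
  refine h2.congr (fun n => ?_)
  push_cast
  ring

lemma wq_bound (x : ℝ) (h0 : 0 < x) (h1 : x < 3/4) (n : ℕ) :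
    1 / (x - ((n:ℝ) + 1))^2 + 1 / (x + ((n:ℝ) + 1))^2 ≤ 17 / ((n:ℝ) + 1)^2 := by
  have hn : (0:ℝ) ≤ n := n.cast_nonneg
  have a : 1 / (x - ((n:ℝ) + 1))^2 ≤ 16 / ((n:ℝ) + 1)^2 := by
    rw [div_le_div_iff₀ (by nlinarith) (by positivity)]
    nlinarith
  have b : 1 / (x + ((n:ℝ) + 1))^2 ≤ 1 / ((n:ℝ) + 1)^2 := by
    apply one_div_le_one_div_of_le (by positivity)
    nlinarith
  calc _ ≤ _ := add_le_add a b
    _ = _ := by ring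

lemma wq_csc (x : ℝ) (h0 : 0 < x) (h1 : x < 3/4) :
    HasSum (fun n : ℕ => 1 / (x - ((n:ℝ) + 1))^2 + 1 / (x + ((n:ℝ) + 1))^2)
      (π^2 / Real.sin (π * x)^2 - 1 / x^2) := by
  have hsum : Summable (fun n : ℕ => 1 / (x - ((n:ℝ) + 1))^2 + 1 / (x + ((n:ℝ) + 1))^2) :=
    Summable.of_nonneg_of_le (fun n => by positivity) (wq_bound x h0 h1) wq_summable
  have hmem : x ∈ Set.Ioo (0:ℝ) (3/4) := ⟨h0, h1⟩
  have hd := hasDerivAt_tsum_of_isPreconnected (𝕜 := ℝ) (F := ℝ)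
    (g := fun (n : ℕ) (x : ℝ) => 1 / (x - ((n:ℝ) + 1)) + 1 / (x + ((n:ℝ) + 1)))
    (g' := fun (n : ℕ) (x : ℝ) => -(1 / (x - ((n:ℝ) + 1))^2 + 1 / (x + ((n:ℝ) + 1))^2))
    (t := Set.Ioo (0:ℝ) (3/4)) (y₀ := x) (y := x)
    wq_summable isOpen_Ioo isPreconnected_Ioo
    (by
      rintro n y ⟨hy0, hy1⟩
      have hn : (0:ℝ) ≤ n := n.cast_nonneg
      have e1 : y - ((n:ℝ) + 1) ≠ 0 := by linarith
      have e2 : y + ((n:ℝ) + 1) ≠ 0 := by positivity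
      have d1 := ((hasDerivAt_id y).sub_const ((n:ℝ) + 1)).inv e1
      have d2 := ((hasDerivAt_id y).add_const ((n:ℝ) + 1)).inv e2
      have := d1.add d2
      convert! this using 1
      · funext z; simp
      · simp; ring)
    (by
      rintro n y ⟨hy0, hy1⟩
      rw [norm_neg, Real.norm_of_nonneg (by positivity)]
      exact wq_bound y hy0 hy1 n)
    hmem (wq_cot x h0 h1).summable hmem
  have hsin : Real.sin (π * x) ≠ 0 := by
    apply ne_of_gt
    apply Real.sin_pos_of_pos_of_lt_pi (by positivity)
    nlinarith [Real.pi_pos]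
  have hd2 : HasDerivAt (fun x : ℝ => π * (Real.cos (π * x) / Real.sin (π * x)) - 1 / x)
      (-(π^2 / Real.sin (π * x)^2 - 1 / x^2)) x := by
    have hl : HasDerivAt (fun x : ℝ => π * x) π x := by
      simpa using (hasDerivAt_id x).const_mul π
    have := (((hl.cos.fun_div hl.sin hsin)).const_mul π).fun_sub (hasDerivAt_inv h0.ne')
    simp only [one_div]
    convert! this using 1
    have := Real.sin_sq_add_cos_sq (π * x)
    field_simp
    linear_combination (π^2 * x^2) * this
  have hev : (fun x : ℝ => π * (Real.cos (π * x) / Real.sin (π * x)) - 1 / x) =ᶠ[nhds x]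
      (fun x => ∑' n : ℕ, (1 / (x - ((n:ℝ) + 1)) + 1 / (x + ((n:ℝ) + 1)))) := by
    filter_upwards [isOpen_Ioo.mem_nhds hmem] with y hy
    exact (wq_cot y hy.1 hy.2).tsum_eq.symm
  have huniq := (hd.congr_of_eventuallyEq hev).unique hd2
  rw [tsum_neg, neg_inj] at huniq
  rw [← huniq]
  exact hsum.hasSum

lemma wq_main (x : ℝ) (h0 : 0 < x) (h1 : x < 3/4) :
    HasSum (fun n : ℕ => 1 / (((n:ℝ) + 1)^2 - x^2)^2)
      (((π * x / Real.sin (π * x))^2 + π * x * Real.cos (π * x) / Real.sin (π * x) - 2)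
        / (4 * x^4)) := by
  have h := (((wq_csc x h0 h1).mul_left (x^2)).add ((wq_cot x h0 h1).mul_left x)).mul_left
    (1 / (4 * x^4))
  convert! h using 1
  · funext n
    have hn : (0:ℝ) ≤ n := n.cast_nonneg
    have e1 : x - ((n:ℝ) + 1) ≠ 0 := by linarith
    have e2 : x + ((n:ℝ) + 1) ≠ 0 := by positivity
    have e3 : ((n:ℝ) + 1)^2 - x^2 ≠ 0 := by
      have : ((n:ℝ) + 1)^2 - x^2 = - ((x - ((n:ℝ) + 1)) * (x + ((n:ℝ) + 1))) := by ring
      rw [this]; exact neg_ne_zero.2 (mul_ne_zero e1 e2)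
    have : ((n:ℝ) + 1)^2 - x^2 = - ((x - ((n:ℝ) + 1)) * (x + ((n:ℝ) + 1))) := by ring
    rw [this]
    field_simp
    ring
  · have hsin : Real.sin (π * x) ≠ 0 := by
      apply ne_of_gt
      apply Real.sin_pos_of_pos_of_lt_pi (by positivity)
      nlinarith [Real.pi_pos]
    field_simp
    ring

theorem wilker_quartic_bounds (t : ℝ) (ht0 : 0 < t) (ht : t < π / 2) :
    2 + (2/45) * t^4 < (t / Real.sin t)^2 + t / Real.tan t ∧
    (t / Real.sin t)^2 + t / Real.tan t < 2 + (4*(π^2 - 8)/π^4) * t^4 := by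
  have hpi := Real.pi_pos
  obtain ⟨x, rfl⟩ : ∃ x, t = π * x := ⟨t / π, by field_simp⟩
  have h0 : 0 < x := pos_of_mul_pos_right ht0 hpi.le
  have h1 : x < 1/2 := by nlinarith
  have hm := wq_main x h0 (by linarith)
  have hh := wq_main (1/2) (by norm_num) (by norm_num)
  have hz : HasSum (fun n : ℕ => 1 / ((n:ℝ) + 1)^4) (π^4/90) := by
    have := (hasSum_nat_add_iff' 1).2 hasSum_zeta_four
    simpa using this
  have hn : ∀ n : ℕ, 0 < ((n:ℝ) + 1)^2 - (1/2)^2 ∧ ((n:ℝ) + 1)^2 - (1/2)^2 < ((n:ℝ) + 1)^2 - x^2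
      ∧ ((n:ℝ) + 1)^2 - x^2 < ((n:ℝ) + 1)^2 := by
    intro n
    have hn : (0:ℝ) ≤ n := n.cast_nonneg
    refine ⟨by nlinarith, by nlinarith, by nlinarith⟩
  have k1 : ∀ n : ℕ, 1 / ((n:ℝ) + 1)^4 < 1 / (((n:ℝ) + 1)^2 - x^2)^2 := by
    intro n
    obtain ⟨a, b, c⟩ := hn n
    apply one_div_lt_one_div_of_lt (pow_pos (a.trans b) 2)
    nlinarith
  have k2 : ∀ n : ℕ, 1 / (((n:ℝ) + 1)^2 - x^2)^2 < 1 / (((n:ℝ) + 1)^2 - (1/2)^2)^2 := by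
    intro n
    obtain ⟨a, b, c⟩ := hn n
    apply one_div_lt_one_div_of_lt (pow_pos a 2)
    nlinarith
  have l1 := hasSum_lt (fun n => (k1 n).le) (k1 0) hz hm
  have l2 := hasSum_lt (fun n => (k2 n).le) (k2 0) hm hh
  rw [show π * (1/2) = π / 2 by ring, Real.sin_pi_div_two, Real.cos_pi_div_two] at l2
  have ht' : π * x / Real.tan (π * x) = π * x * Real.cos (π * x) / Real.sin (π * x) := by
    rw [Real.tan_eq_sin_div_cos, div_div_eq_mul_div]
  rw [ht']
  have hx4 : 0 < 4 * x^4 := by positivity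
  rw [lt_div_iff₀ hx4] at l1
  rw [div_lt_iff₀ hx4] at l2
  constructor
  · have : (2/45) * (π * x)^4 = π^4/90 * (4 * x^4) := by ring
    linarith
  · have : (4*(π^2 - 8)/π^4) * (π * x)^4 =
      ((π / 2 / 1) ^ 2 + π / 2 * 0 / 1 - 2) / (4 * (1 / 2) ^ 4) * (4 * x ^ 4) := by
      field_simp
      ring
    linarith
end
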